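/- arXiv:2203.06435 — 2 statements merged into one kernel-verified Lean document; each statement's English description precedes it below -/
import Mathlib

section
/- Let n be a natural number and N an n×n matrix with integer entries. Inside the group (ℂˣ)ⁿ (functions Fin n → ℂˣ with pointwise multiplication), consider the subgroup F = { t | for every i, ∏_j (t j)^(N i j) = 1 } and the subset E = { t | there exists v : Fin n → ℂ with ∑_j (N i j)·(v j) = 0 for all i and t j = exp(v j) for all j }. Then E is a subgroup of (ℂˣ)ⁿ contained in F, and E has finite index in F; equivalently, F is a finite union of cosets of E. -/
/-- For an integer matrix `N`, the subgroup `F` of the complex torus `(ℂˣ)ⁿ` consisting of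
those `t` with `∏ j, (t j)^(N i j) = 1` for every `i`. -/
def torusSubgroupF (n : ℕ) (N : Matrix (Fin n) (Fin n) ℤ) : Subgroup (Fin n → ℂˣ) where
  carrier := {t | ∀ i, ∏ j, t j ^ N i j = 1}
  one_mem' := fun i => by simp
  mul_mem' := fun {a b} ha hb i => by
    simp only [Pi.mul_apply, mul_zpow, Finset.prod_mul_distrib]
    rw [ha i, hb i, mul_one]
  inv_mem' := fun {a} ha i => by
    simp only [Pi.inv_apply, inv_zpow, Finset.prod_inv_distrib]
    rw [ha i, inv_one]

/-- For an integer matrix `N`, the subgroup `E` of `(ℂˣ)ⁿ` of points `t = exp v` for `v` in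
the complex kernel of `N`; it is the identity component of `torusSubgroupF n N`. -/
def torusSubgroupE (n : ℕ) (N : Matrix (Fin n) (Fin n) ℤ) : Subgroup (Fin n → ℂˣ) where
  carrier := {t | ∃ v : Fin n → ℂ, (∀ i, ∑ j, (N i j : ℂ) * v j = 0) ∧
      ∀ j, (t j : ℂ) = Complex.exp (v j)}
  one_mem' := ⟨0, fun i => by simp, fun j => by simp⟩
  mul_mem' := by
    rintro a b ⟨v, hv, hav⟩ ⟨w, hw, hbw⟩
    refine ⟨v + w, fun i => ?_, fun j => ?_⟩
    · simp only [Pi.add_apply, mul_add, Finset.sum_add_distrib]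
      rw [hv i, hw i, add_zero]
    · simp only [Pi.mul_apply, Units.val_mul, Pi.add_apply, Complex.exp_add]
      rw [hav j, hbw j]
  inv_mem' := by
    rintro a ⟨v, hv, hav⟩
    refine ⟨-v, fun i => ?_, fun j => ?_⟩
    · have h : ∑ j : Fin n, (N i j : ℂ) * (-v) j = -∑ j : Fin n, (N i j : ℂ) * v j := by
        rw [← Finset.sum_neg_distrib]
        exact Finset.sum_congr rfl fun j _ => by simp
      rw [h, hv i, neg_zero]
    · simp only [Pi.inv_apply, Pi.neg_apply, Complex.exp_neg]
      rw [← hav j, Units.val_inv_eq_inv_val]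

/-- Every integer matrix has an integral quasi-inverse up to a positive integer factor. -/
theorem Matrix.exists_int_quasi_inverse {n : ℕ} (N : Matrix (Fin n) (Fin n) ℤ) :
    ∃ d : ℕ, d ≠ 0 ∧ ∃ Q : Matrix (Fin n) (Fin n) ℤ, N * Q * N = (d : ℤ) • N := by
  set f := Matrix.toLin' (N.map (Int.cast : ℤ → ℚ)) with hf
  obtain ⟨g, hg⟩ := f.rangeRestrict.exists_rightInverse_of_surjective f.range_rangeRestrict
  obtain ⟨h, hh⟩ := LinearMap.exists_extend g
  have hfhf : f ∘ₗ h ∘ₗ f = f := by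
    refine LinearMap.ext fun x => ?_
    have h1 : h (f x) = g (f.rangeRestrict x) := LinearMap.congr_fun hh (f.rangeRestrict x)
    have h2 := congrArg Subtype.val (LinearMap.congr_fun hg (f.rangeRestrict x))
    simpa [h1] using h2
  obtain ⟨P, rfl⟩ := Matrix.toLin'.surjective h
  rw [hf, ← Matrix.toLin'_mul, ← Matrix.toLin'_mul, ← Matrix.mul_assoc] at hfhf
  replace hfhf := Matrix.toLin'.injective hfhf
  obtain ⟨d, hd⟩ := IsLocalization.exist_integer_multiples_of_finite (nonZeroDivisors ℤ)
    (fun p : Fin n × Fin n => P p.1 p.2)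
  choose q hq using hd
  have hd0 : (d : ℤ) ≠ 0 := nonZeroDivisors.coe_ne_zero d
  have key : N * Matrix.of (fun i j => q (i, j)) * N = (d : ℤ) • N := by
    have hQ : (Matrix.of fun i j => q (i, j)).map (Int.cast : ℤ → ℚ) = ((d : ℤ) : ℚ) • P := by
      ext i j
      simpa using hq (i, j)
    apply Matrix.map_injective (Int.cast_injective (α := ℚ))
    change (N * Matrix.of (fun i j => q (i, j)) * N).map (Int.castRingHom ℚ) = _
    rw [Matrix.map_mul, Matrix.map_mul]
    change N.map (Int.cast : ℤ → ℚ) * (Matrix.of fun i j => q (i, j)).map (Int.cast : ℤ → ℚ) *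
      N.map (Int.cast : ℤ → ℚ) = _
    rw [hQ, Matrix.mul_smul, Matrix.smul_mul, hfhf]
    ext i j
    simp [-zsmul_eq_mul]
  rcases Int.natAbs_eq (d : ℤ) with h0 | h0
  · exact ⟨(d : ℤ).natAbs, Int.natAbs_ne_zero.2 hd0, _, h0 ▸ key⟩
  · refine ⟨(d : ℤ).natAbs, Int.natAbs_ne_zero.2 hd0, -Matrix.of (fun i j => q (i, j)), ?_⟩
    rw [Matrix.mul_neg, Matrix.neg_mul, key, ← neg_smul]
    congr 1
    omega

theorem torusSubgroupE_le_torusSubgroupF (n : ℕ) (N : Matrix (Fin n) (Fin n) ℤ) :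
    torusSubgroupE n N ≤ torusSubgroupF n N := by
  rintro t ⟨v, hv, htv⟩ i
  ext
  simp only [Units.coe_prod, Units.val_zpow_eq_zpow_val, htv, ← Complex.exp_int_mul,
    ← Complex.exp_sum, hv i, Complex.exp_zero, Units.val_one]

/-- Coordinatewise logarithms of a point of `torusSubgroupF n N` are sent by `N` to
integral multiples of `2πi`. -/
theorem exists_log_of_mem_torusSubgroupF {n : ℕ} {N : Matrix (Fin n) (Fin n) ℤ}
    {t : Fin n → ℂˣ} (ht : t ∈ torusSubgroupF n N) :
    ∃ (w : Fin n → ℂ) (m : Fin n → ℤ), (∀ j, (t j : ℂ) = Complex.exp (w j)) ∧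
      ∀ i, ∑ j, (N i j : ℂ) * w j = m i * (2 * Real.pi * Complex.I) := by
  have hexp (j : Fin n) : (t j : ℂ) = Complex.exp (Complex.log (t j)) :=
    (Complex.exp_log (t j).ne_zero).symm
  have hm (i : Fin n) : ∃ m : ℤ,
      ∑ j, (N i j : ℂ) * Complex.log (t j) = m * (2 * Real.pi * Complex.I) := by
    rw [← Complex.exp_eq_one_iff, Complex.exp_sum]
    simp only [Complex.exp_int_mul, ← hexp]
    simpa using congrArg Units.val (ht i)
  choose m hm using hm
  exact ⟨fun j => Complex.log (t j), m, hexp, hm⟩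

/-- If `N` sends logarithms of `t` to multiples of `2πi * d`, where `d` admits an integral
quasi-inverse of `N`, then `t` lies in `torusSubgroupE n N`. -/
theorem mem_torusSubgroupE_of_log {n d : ℕ} {N Q : Matrix (Fin n) (Fin n) ℤ} (hd : d ≠ 0)
    (hQ : N * Q * N = (d : ℤ) • N) {t : Fin n → ℂˣ} {w : Fin n → ℂ} {k : Fin n → ℤ}
    (htw : ∀ j, (t j : ℂ) = Complex.exp (w j))
    (hw : ∀ i, ∑ j, (N i j : ℂ) * w j = (d * k i : ℤ) * (2 * Real.pi * Complex.I)) :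
    t ∈ torusSubgroupE n N := by
  set c : ℂ := 2 * Real.pi * Complex.I with hc
  have hc0 : c ≠ 0 := Complex.two_pi_I_ne_zero
  have hd0 : (d : ℂ) ≠ 0 := Nat.cast_ne_zero.2 hd
  set A : Matrix (Fin n) (Fin n) ℂ := N.map (Int.castRingHom ℂ) with hA
  set B : Matrix (Fin n) (Fin n) ℂ := Q.map (Int.castRingHom ℂ) with hB
  set κ : Fin n → ℂ := fun i => k i
  have hABA : A * B * A = (d : ℂ) • A := by
    rw [hA, hB, ← Matrix.map_mul, ← Matrix.map_mul, hQ]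
    ext i j
    simp [-zsmul_eq_mul, -nsmul_eq_mul]
  have hAw : A.mulVec w = (d * c) • κ := by
    ext i
    have := hw i
    simp only [hA, κ, Matrix.mulVec, dotProduct, Matrix.map_apply, eq_intCast, this,
      Pi.smul_apply, smul_eq_mul]
    push_cast
    ring
  have hABκ : (A * B).mulVec κ = (d : ℂ) • κ := by
    have h1 : (d * c) • (A * B).mulVec κ = (d * c) • ((d : ℂ) • κ) := by
      rw [← Matrix.mulVec_smul, ← hAw, Matrix.mulVec_mulVec, hABA, Matrix.smul_mulVec, hAw,
        smul_comm]
    exact smul_right_injective _ (mul_ne_zero hd0 hc0) h1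
  have hker : A.mulVec (w - c • B.mulVec κ) = 0 := by
    rw [Matrix.mulVec_sub, Matrix.mulVec_smul, Matrix.mulVec_mulVec, hABκ, hAw, smul_smul,
      mul_comm c, sub_self]
  refine ⟨w - c • B.mulVec κ, fun i => congrFun hker i, fun j => ?_⟩
  have hBκ : B.mulVec κ j = ((Q.mulVec k j : ℤ) : ℂ) := by
    simp [hB, κ, Matrix.mulVec, dotProduct]
  rw [htw, Complex.exp_eq_exp_iff_exists_int]
  refine ⟨Q.mulVec k j, ?_⟩
  simp only [Pi.sub_apply, Pi.smul_apply, smul_eq_mul, hBκ]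
  ring

/-- A subgroup has finite index if its cosets are separated by a map to a finite type. -/
theorem Subgroup.finiteIndex_of_separating_map {G α : Type*} [Group G] [Finite α]
    (H : Subgroup G) (f : G → α) (hf : ∀ a b, f a = f b → a⁻¹ * b ∈ H) : H.FiniteIndex := by
  have : Finite (G ⧸ H) := by
    refine Finite.of_injective (fun q : G ⧸ H => f q.out) fun p q hpq => ?_
    rw [← p.out_eq, ← q.out_eq]
    exact QuotientGroup.eq.2 (hf _ _ hpq)
  exact H.finiteIndex_of_finite_quotient

/-- `E` is a subgroup of `(ℂˣ)ⁿ` contained in `F`, of finite index in `F`; equivalently,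
`F` is a finite union of cosets of `E`. -/
theorem torusSubgroupE_le_finiteIndex (n : ℕ) (N : Matrix (Fin n) (Fin n) ℤ) :
    torusSubgroupE n N ≤ torusSubgroupF n N ∧
      ((torusSubgroupE n N).subgroupOf (torusSubgroupF n N)).FiniteIndex := by
  refine ⟨torusSubgroupE_le_torusSubgroupF n N, ?_⟩
  obtain ⟨d, hd, Q, hQ⟩ := N.exists_int_quasi_inverse
  have : NeZero d := ⟨hd⟩
  choose w m hexp hm using fun t : torusSubgroupF n N => exists_log_of_mem_torusSubgroupF t.2
  refine Subgroup.finiteIndex_of_separating_map _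
    (fun t (i : Fin n) => (m t i : ZMod d)) fun s t hst => ?_
  have hdvd (i : Fin n) : (d : ℤ) ∣ m t i - m s i :=
    (ZMod.intCast_eq_intCast_iff_dvd_sub _ _ _).1 (congrFun hst i)
  choose k hk using hdvd
  rw [Subgroup.mem_subgroupOf]
  refine mem_torusSubgroupE_of_log (w := w t - w s) (k := k) hd hQ (fun j => ?_) fun i => ?_
  · simp [hexp, Complex.exp_sub, div_eq_inv_mul]
  · simp only [Pi.sub_apply, mul_sub, Finset.sum_sub_distrib, hm, ← hk]
    push_cast
    ring
end

section
/- Let σ be the unique ℂ-algebra automorphism of the Laurent polynomial ring ℂ[T,T⁻¹] satisfying σ(T n) = T(−n) for all integers n. Then { f ∈ ℂ[T,T⁻¹] | σ f = −(T 2) · f } = { (1 − T(−2)) · g | g ∈ ℂ[T,T⁻¹], σ g = g }. Moreover g ↦ (1 − T(−2)) · g is injective, so this set is a free module of rank one over the fixed subring { g | σ g = g }. -/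
open LaurentPolynomial

namespace LaurentPolynomial

theorem T_one_sub_T_neg_one_dvd {R : Type*} [CommRing R] (n : ℤ) :
    (T 1 - T (-1) : R[T;T⁻¹]) ∣ T n - T (-n) := by
  have key (k : ℕ) : (T 1 - T (-1) : R[T;T⁻¹]) ∣ T k - T (-k) := by
    have h1 : (T 1 - T (-1) : R[T;T⁻¹]) ∣ T 2 - 1 :=
      ⟨T 1, by rw [sub_mul, ← T_add, ← T_add]; norm_num⟩
    have h2 : (T k - T (-k) : R[T;T⁻¹]) = (T 2 ^ k - 1) * T (-k) := by
      rw [sub_mul, one_mul, T_pow, ← T_add]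
      congr 2
      ring
    rw [h2]
    exact (h1.trans (sub_one_dvd_pow_sub_one _ k)).mul_right _
  obtain ⟨k, rfl | rfl⟩ := n.eq_nat_or_neg
  · exact key k
  · rw [neg_neg, dvd_sub_comm]
    exact key k

theorem T_one_sub_T_neg_one_dvd_sub_invert {R : Type*} [CommRing R] (f : R[T;T⁻¹]) :
    (T 1 - T (-1) : R[T;T⁻¹]) ∣ f - invert f := by
  induction f using LaurentPolynomial.induction_on' with
  | add p q hp hq =>
    rw [map_add, add_sub_add_comm]
    exact dvd_add hp hq
  | C_mul_T n a =>
    rw [map_mul, invert_C, invert_T, ← mul_sub]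
    exact (T_one_sub_T_neg_one_dvd n).mul_left _

theorem eq_invert_of_map_T {R : Type*} [CommRing R] (σ : R[T;T⁻¹] ≃ₐ[R] R[T;T⁻¹])
    (hσ : ∀ n : ℤ, σ (T n) = T (-n)) : σ = invert := by
  ext f : 1
  induction f using LaurentPolynomial.induction_on' with
  | add p q hp hq => rw [map_add, map_add, hp, hq]
  | C_mul_T n a => rw [← smul_eq_C_mul, map_smul, map_smul, hσ, invert_T]

theorem one_sub_T_ne_zero {R : Type*} [CommRing R] [Nontrivial R] {n : ℤ} (hn : n ≠ 0) :
    (1 - T n : R[T;T⁻¹]) ≠ 0 := by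
  intro h
  simpa [← T_zero, hn] using congrArg (fun p => p.coeff 0) h

end LaurentPolynomial

/-- Let `σ` be the (unique) `ℂ`-algebra automorphism of `ℂ[T,T⁻¹]` with `σ (T n) = T (-n)`
for all integers `n` (induced by inversion `z ↦ z⁻¹` on `ℂˣ`). The Laurent polynomials `f`
with `σ f = -z²·f` are exactly the multiples of `1 - z⁻² = 1 - T (-2)` by `σ`-invariant
Laurent polynomials, and multiplication by `1 - T (-2)` is injective on the fixed subring;
hence these `f` form a free module of rank one over the fixed subring. -/
theorem twisted_antiInvariants_inversion
    (σ : LaurentPolynomial ℂ ≃ₐ[ℂ] LaurentPolynomial ℂ)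
    (hσ : ∀ n : ℤ, σ (T n) = T (-n)) :
    ({f : LaurentPolynomial ℂ | σ f = -(T 2) * f} =
      {f : LaurentPolynomial ℂ | ∃ g : LaurentPolynomial ℂ,
        σ g = g ∧ f = (1 - T (-2)) * g}) ∧
    Function.Injective (fun g : {g : LaurentPolynomial ℂ // σ g = g} =>
      (1 - T (-2)) * (g : LaurentPolynomial ℂ)) := by
  obtain rfl := eq_invert_of_map_T σ hσ
  have hne : (1 - T (-2) : ℂ[T;T⁻¹]) ≠ 0 := one_sub_T_ne_zero (by norm_num)
  have hT : (T 2 * T (-2) : ℂ[T;T⁻¹]) = 1 := by rw [← T_add]; simp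
  have hinv : invert (1 - T (-2) : ℂ[T;T⁻¹]) = -(T 2) * (1 - T (-2)) := by
    rw [map_sub, map_one, invert_T, neg_neg]
    linear_combination -hT
  refine ⟨Set.ext fun f => ⟨fun hf => ?_, ?_⟩, fun g₁ g₂ h => Subtype.ext (mul_left_cancel₀ hne h)⟩
  · have hf : invert f = -(T 2) * f := hf
    have h11 : (T (-1) * T 1 : ℂ[T;T⁻¹]) = 1 := by rw [← T_add]; simp
    have h12 : (T (-1) * T 2 : ℂ[T;T⁻¹]) = T 1 := by rw [← T_add]; norm_num
    have h22 : (T (-1) * T (-1) : ℂ[T;T⁻¹]) = T (-2) := by rw [← T_add]; norm_num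
    obtain ⟨g, hg⟩ := T_one_sub_T_neg_one_dvd_sub_invert (T 1 * f)
    rw [map_mul, invert_T, hf] at hg
    have hC : (C (1 / 2) * 2 : ℂ[T;T⁻¹]) = 1 := by
      rw [← map_ofNat C 2, ← map_mul]
      norm_num
    have hfg : f = (1 - T (-2)) * (C (1 / 2) * g) := by
      linear_combination C (1 / 2) * T (-1) * hg - f * hC - C (1 / 2) * g * h22
        + C (1 / 2) * g * h11 - C (1 / 2) * f * h11 - C (1 / 2) * T (-1) * f * h12
        - C (1 / 2) * f * h11
    refine ⟨C (1 / 2) * g, ?_, hfg⟩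
    generalize C (1 / 2) * g = q at hfg ⊢
    rw [hfg, map_mul, hinv, ← mul_assoc] at hf
    refine mul_left_cancel₀ (mul_ne_zero (neg_ne_zero.2 (isUnit_T 2).ne_zero) hne) hf
  · rintro ⟨g, hg, rfl⟩
    change invert _ = _
    rw [map_mul, hinv, hg, mul_assoc]
end
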